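/- Let w = (w_1, …, w_r) be a finite nonempty word in the letters {T, R}, and for each j ≥ 0 let (X, v^{(j)}) be the state obtained by applying w_r ∘ ⋯ ∘ w_1 to the initial state (UP, e_0) in F^{j+1}. Assume the final type X is UP or OP, and define for each j ≥ 0: P_j := ∑_{k=0}^{j} v^{(j)}_k · a^{−j} q^{j²+k²} [j;k]_+ (a² q^{2−2j−2k}; q²)_j / (q²;q²)_j if X = UP, and P_j := ∑_{k=0}^{j} v^{(j)}_k · a^{k−j} q^{(j−k)²} [j;k]_+ (a² q^{2−2j}; q²)_{j−k} / (q²;q²)_{j−k} if X = OP (these are the reduced j-colored HOMFLY-PT polynomials of the rational link obtained by numerator closure of the tangle). Then there exist an integer n ≥ 1, a symmetric matrix Q ∈ M_n(ℤ), and vectors 𝐪, 𝐚 ∈ ℤ^n such that for all j ≥ 0: P_j = ∑_{d ∈ ℕ^n, d_1+⋯+d_n = j} (−q)^{𝐪·d} a^{𝐚·d} q^{dᵀQd} / ∏_{i=1}^{n} (q²;q²)_{d_i}. (This is the links–quivers correspondence for rational links: the generating function ∑_j P_j x^j is a specialization of the motivic Donaldson–Thomas generating function of a symmetric quiver.) 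-/

import Mathlib

noncomputable section

open Finset

/-- The field `ℚ(q, a)` of rational functions in two variables. -/
abbrev F : Type := FractionRing (MvPolynomial (Fin 2) ℚ)

/-- The variable `q`. -/
def q : F := algebraMap (MvPolynomial (Fin 2) ℚ) F (MvPolynomial.X 0)

/-- The variable `a`. -/
def a : F := algebraMap (MvPolynomial (Fin 2) ℚ) F (MvPolynomial.X 1)

/-- The q-Pochhammer symbol `(x; y)_n = ∏_{j=0}^{n-1} (1 - x yʲ)`. -/
def qPoch (x y : F) (n : ℕ) : F := ∏ i ∈ Finset.range n, (1 - x * y ^ i)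

/-- `(q²;q²)_m = ∏_{i=1}^{m} (1 - q^{2i})`. -/
def qp (m : ℕ) : F := qPoch (q ^ 2) (q ^ 2) m

/-- The positive quantum binomial coefficient `[N; k]₊`. -/
def qbin (N k : ℕ) : F := qp N / (qp k * qp (N - k))

/-- Boundary orientation types of a 4-ended tangle. -/
inductive TangleType | UP | OP | RI
  deriving DecidableEq

/-- The two elementary twist operations: top twist `T` and right twist `R`. -/
inductive Letter | T | R
  deriving DecidableEq

/-- The boundary orientation type after applying one twist. -/
def typeStep : Letter → TangleType → TangleType
  | Letter.T, TangleType.UP => TangleType.UP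
  | Letter.T, TangleType.OP => TangleType.RI
  | Letter.T, TangleType.RI => TangleType.OP
  | Letter.R, TangleType.UP => TangleType.OP
  | Letter.R, TangleType.OP => TangleType.UP
  | Letter.R, TangleType.RI => TangleType.RI

/-- The boundary orientation type after applying a word of twists. -/
def typeWord : List Letter → TangleType → TangleType
  | [], X => X
  | l :: w, X => typeWord w (typeStep l X)

/-- The coefficient of the basis web `e_h` in the twist `l` applied to `(X, e_k)`,
for the `j`-colored HOMFLY-PT skein twist rules. -/
def coef (l : Letter) (X : TangleType) (j k h : ℕ) : F :=
  match l, X with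
  | Letter.T, TangleType.UP =>
      if k ≤ h ∧ h ≤ j then
        (-q) ^ ((h : ℤ) - (j : ℤ)) * q ^ ((k : ℤ) ^ 2) * qbin h k
      else 0
  | Letter.T, TangleType.OP =>
      if k ≤ h ∧ h ≤ j then
        (-q) ^ (h : ℤ) * a ^ (k : ℤ) *
          q ^ ((k : ℤ) ^ 2 - 2 * (j : ℤ) * (k : ℤ)) * qbin h k
      else 0
  | Letter.T, TangleType.RI =>
      if k ≤ h ∧ h ≤ j then
        (-q) ^ (h : ℤ) * a ^ (h : ℤ) *
          q ^ ((k : ℤ) ^ 2 - 2 * (j : ℤ) * (h : ℤ)) * qbin h k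
      else 0
  | Letter.R, TangleType.UP =>
      if h ≤ k then
        (-q) ^ ((h : ℤ) - (j : ℤ)) * a ^ ((h : ℤ) - (j : ℤ)) *
          q ^ (-2 * (k : ℤ) * (h : ℤ) + (k : ℤ) ^ 2 + (j : ℤ) ^ 2) * qbin (j - h) (k - h)
      else 0
  | Letter.R, TangleType.OP =>
      if h ≤ k then
        (-q) ^ ((h : ℤ) - (j : ℤ)) * a ^ ((k : ℤ) - (j : ℤ)) *
          q ^ (2 * (h : ℤ) * ((j : ℤ) - (k : ℤ)) + ((k : ℤ) - (j : ℤ)) ^ 2) *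
          qbin (j - h) (k - h)
      else 0
  | Letter.R, TangleType.RI =>
      if h ≤ k then
        (-q) ^ (h : ℤ) *
          q ^ ((h : ℤ) * (2 * (j : ℤ) - 2 * (k : ℤ)) + (k : ℤ) ^ 2 - (j : ℤ) ^ 2) *
          qbin (j - h) (k - h)
      else 0

/-- One twist applied (F-linearly) to the vector part of a state in `F^{j+1}`. -/
def stepVec (l : Letter) (X : TangleType) (j : ℕ) (v : Fin (j + 1) → F) :
    Fin (j + 1) → F :=
  fun h => ∑ k : Fin (j + 1), v k * coef l X j (k : ℕ) (h : ℕ)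

/-- The vector part of the state obtained by applying a word of twists to `(X, v)`. -/
def runVec : List Letter → TangleType → (j : ℕ) → (Fin (j + 1) → F) → (Fin (j + 1) → F)
  | [], _, _, v => v
  | l :: w, X, j, v => runVec w (typeStep l X) j (stepVec l X j v)

/-- The initial vector `e_0` (the trivial tangle). -/
def e0 (j : ℕ) : Fin (j + 1) → F := fun k => if (k : ℕ) = 0 then 1 else 0

/-- The reduced numerator closure applied to a state of type `UP`. -/
def closeUP (j : ℕ) (v : Fin (j + 1) → F) : F :=
  ∑ k : Fin (j + 1), v k *
    (a ^ (-(j : ℤ)) * q ^ ((j : ℤ) ^ 2 + ((k : ℕ) : ℤ) ^ 2) * qbin j (k : ℕ) *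
      (qPoch (a ^ 2 * q ^ (2 - 2 * (j : ℤ) - 2 * ((k : ℕ) : ℤ))) (q ^ 2) j / qp j))

/-- The reduced numerator (north–south) closure applied to a state of type `OP`. -/
def closeOP (j : ℕ) (v : Fin (j + 1) → F) : F :=
  ∑ k : Fin (j + 1), v k *
    (a ^ (((k : ℕ) : ℤ) - (j : ℤ)) * q ^ (((j : ℤ) - ((k : ℕ) : ℤ)) ^ 2) * qbin j (k : ℕ) *
      (qPoch (a ^ 2 * q ^ (2 - 2 * (j : ℤ))) (q ^ 2) (j - (k : ℕ)) / qp (j - (k : ℕ))))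

/-! ### Gaussian binomial coefficients -/

/-- The Gaussian binomial coefficient at parameter `Q`, defined by Pascal's rule. -/
def gaussBin {K : Type*} [CommRing K] (Q : K) : ℕ → ℕ → K
  | _, 0 => 1
  | 0, _ + 1 => 0
  | n + 1, m + 1 => gaussBin Q n m + Q ^ (m + 1) * gaussBin Q n (m + 1)

section GaussBin

variable {K : Type*} [CommRing K] (Q : K)

@[simp] lemma gaussBin_zero_right (n : ℕ) : gaussBin Q n 0 = 1 := by
  cases n <;> rfl

@[simp] lemma gaussBin_zero_succ (m : ℕ) : gaussBin Q 0 (m + 1) = 0 := rfl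

lemma gaussBin_succ_succ (n m : ℕ) :
    gaussBin Q (n + 1) (m + 1) = gaussBin Q n m + Q ^ (m + 1) * gaussBin Q n (m + 1) := rfl

lemma gaussBin_eq_zero_of_lt {n m : ℕ} (h : n < m) : gaussBin Q n m = 0 := by
  induction n generalizing m with
  | zero => obtain ⟨m, rfl⟩ := Nat.exists_eq_succ_of_ne_zero (by omega : m ≠ 0); rfl
  | succ n ih =>
    obtain ⟨m, rfl⟩ := Nat.exists_eq_succ_of_ne_zero (by omega : m ≠ 0)
    rw [Nat.succ_eq_add_one, gaussBin_succ_succ, ih (by omega), ih (by omega)]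
    simp

/-- Gaussian binomials as quotients of `q`-factorials `φ`. -/
lemma gaussBin_mul_mul {φ : ℕ → K} (h0 : φ 0 = 1)
    (hφ : ∀ n, φ (n + 1) = φ n * (1 - Q ^ (n + 1))) (x y : ℕ) :
    gaussBin Q (x + y) y * (φ x * φ y) = φ (x + y) := by
  suffices H : ∀ n x y, x + y = n → gaussBin Q n y * (φ x * φ y) = φ n from H _ x y rfl
  intro n
  induction n with
  | zero =>
    intro x y h
    obtain ⟨rfl, rfl⟩ : x = 0 ∧ y = 0 := by omega
    simp [h0]
  | succ n ih =>
    intro x y h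
    rcases y with _ | y
    · obtain rfl : x = n + 1 := h
      simp [h0]
    rw [gaussBin_succ_succ]
    have h1 := ih x y (by omega)
    rcases x with _ | x
    · obtain rfl : y = n := by omega
      rw [gaussBin_eq_zero_of_lt Q (Nat.lt_succ_self y), hφ y]
      linear_combination (1 - Q ^ (y + 1)) * h1
    · have h2 := ih x (y + 1) (by omega)
      obtain rfl : n = x + 1 + y := by omega
      rw [hφ (x + 1 + y)]
      have e1 := hφ x
      have e2 := hφ y
      have e3 : Q ^ (x + 1 + y + 1) = Q ^ (x + 1) * Q ^ (y + 1) := by ring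
      rw [e3]
      linear_combination (1 - Q ^ (y + 1)) * h1 + Q ^ (y + 1) * (1 - Q ^ (x + 1)) * h2
        + gaussBin Q (x + 1 + y) y * φ (x + 1) * e2
        + Q ^ (y + 1) * gaussBin Q (x + 1 + y) (y + 1) * φ (y + 1) * e1

/-- The `q`-Vandermonde convolution. -/
lemma gaussBin_add (c d m : ℕ) :
    gaussBin Q (c + d) m = ∑ p ∈ antidiagonal m,
      gaussBin Q c p.1 * gaussBin Q d p.2 * Q ^ ((c - p.1) * p.2) := by
  induction c generalizing m with
  | zero =>
    rcases m with _ | m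
    · simp
    · rw [Finset.Nat.sum_antidiagonal_succ]
      simp
  | succ c ih =>
    rcases m with _ | m
    · simp
    rw [show c + 1 + d = c + d + 1 by ring,
      gaussBin_succ_succ, ih, ih, Finset.Nat.sum_antidiagonal_succ,
      Finset.Nat.sum_antidiagonal_succ]
    simp only [gaussBin_succ_succ, gaussBin_zero_right, Nat.add_sub_add_right, Nat.sub_zero]
    rw [mul_add, Finset.mul_sum]
    simp only [add_mul, Finset.sum_add_distrib]
    have key : ∀ p ∈ antidiagonal m,
        Q ^ (p.1 + 1) * gaussBin Q c (p.1 + 1) * gaussBin Q d p.2 * Q ^ ((c - p.1) * p.2) =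
        Q ^ (m + 1) * (gaussBin Q c (p.1 + 1) * gaussBin Q d p.2 *
          Q ^ ((c - (p.1 + 1)) * p.2)) := by
      intro p hp
      rw [HasAntidiagonal.mem_antidiagonal] at hp
      rcases lt_or_ge c (p.1 + 1) with h | h
      · simp [gaussBin_eq_zero_of_lt Q h]
      · obtain ⟨e, rfl⟩ := Nat.exists_eq_add_of_le h
        rw [← hp, show p.1 + 1 + e - p.1 = e + 1 by omega,
          show p.1 + 1 + e - (p.1 + 1) = e by omega]
        ring
    rw [Finset.sum_congr rfl key]
    ring

end GaussBin

lemma qPoch_zero (x y : F) : qPoch x y 0 = 1 := by simp [qPoch]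

lemma qPoch_add (x y : F) (m n : ℕ) :
    qPoch x y (m + n) = qPoch x y m * qPoch (x * y ^ m) y n := by
  simp only [qPoch, Finset.prod_range_add, pow_add, mul_assoc]

lemma q_ne_zero : q ≠ 0 := by
  simp [q]

lemma a_ne_zero : a ≠ 0 := by
  simp [a]

lemma neg_q_ne_zero : -q ≠ 0 := neg_ne_zero.2 q_ne_zero

lemma q_pow_ne_one {n : ℕ} (hn : n ≠ 0) : q ^ n ≠ 1 := by
  intro h
  rw [q, ← map_pow, ← map_one (algebraMap (MvPolynomial (Fin 2) ℚ) F)] at h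
  have h' := congrArg (MvPolynomial.eval fun _ => (0 : ℚ))
    (IsFractionRing.injective (MvPolynomial (Fin 2) ℚ) F h)
  simp [hn] at h'

lemma qp_zero : qp 0 = 1 := qPoch_zero _ _

lemma qp_succ (n : ℕ) : qp (n + 1) = qp n * (1 - (q ^ 2) ^ (n + 1)) := by
  rw [qp, qp, qPoch, Finset.prod_range_succ, pow_succ' (q ^ 2) n]
  rfl

lemma qp_ne_zero (n : ℕ) : qp n ≠ 0 := by
  rw [qp, qPoch, Finset.prod_ne_zero_iff]
  intro i _ h
  refine q_pow_ne_one (n := 2 * (i + 1)) (by omega) ?_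
  linear_combination -h

lemma qp_add (x y : ℕ) : qp (x + y) = qp x * qPoch (q ^ (2 * (x + 1))) (q ^ 2) y := by
  rw [qp, qPoch_add, qp]
  congr 2
  ring

lemma gaussBin_mul_qp (x y : ℕ) : gaussBin (q ^ 2) (x + y) y * (qp x * qp y) = qp (x + y) :=
  gaussBin_mul_mul _ qp_zero qp_succ x y

lemma qbin_mul_qp (x y : ℕ) : qbin (x + y) y * (qp x * qp y) = qp (x + y) := by
  have hx := qp_ne_zero x
  have hy := qp_ne_zero y
  rw [qbin, Nat.add_sub_cancel]
  field_simp

/-- The `q`-binomial theorem. -/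
lemma qPoch_eq_sum (x : F) (n : ℕ) :
    qPoch x (q ^ 2) n = ∑ p ∈ antidiagonal n,
      gaussBin (q ^ 2) n p.2 * ((-q) ^ (-(p.2 : ℤ)) * q ^ ((p.2 : ℤ) ^ 2) * x ^ p.2) := by
  have hq := q_ne_zero
  rw [← Finset.Nat.sum_antidiagonal_swap]
  simp only [Prod.snd_swap]
  rw [Finset.Nat.sum_antidiagonal_eq_sum_range_succ_mk]
  dsimp only
  induction n generalizing x with
  | zero => simp [qPoch_zero]
  | succ n ih =>
    have hstep : qPoch x (q ^ 2) (n + 1) = (1 - x) * qPoch (x * q ^ 2) (q ^ 2) n := by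
      rw [add_comm, qPoch_add]
      simp [qPoch]
    have hc : ∀ m : ℕ, (-q) ^ (-((m + 1 : ℕ) : ℤ)) * q ^ (((m + 1 : ℕ) : ℤ) ^ 2) =
        -((q ^ 2) ^ m * ((-q) ^ (-(m : ℤ)) * q ^ ((m : ℤ) ^ 2))) := by
      intro m
      have e1 : (-q) ^ (-((m + 1 : ℕ) : ℤ)) = (-q) ^ (-(m : ℤ)) * (-q)⁻¹ := by
        rw [← zpow_neg_one (-q), ← zpow_add₀ neg_q_ne_zero]
        push_cast
        ring_nf
      have e2 : q ^ (((m + 1 : ℕ) : ℤ) ^ 2) = q ^ ((m : ℤ) ^ 2) * (q ^ 2) ^ m * q := by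
        rw [← pow_mul, ← zpow_natCast, ← zpow_add₀ hq, ← zpow_add_one₀ hq]
        push_cast
        ring_nf
      rw [e1, e2, inv_neg]
      field_simp
    rw [hstep, ih, Finset.sum_range_succ' _ (n + 1)]
    simp only [gaussBin_succ_succ]
    have hsplit : ∀ m ∈ range (n + 1),
        (gaussBin (q ^ 2) n m + (q ^ 2) ^ (m + 1) * gaussBin (q ^ 2) n (m + 1)) *
          ((-q) ^ (-((m + 1 : ℕ) : ℤ)) * q ^ (((m + 1 : ℕ) : ℤ) ^ 2) * x ^ (m + 1)) =
        -x * (gaussBin (q ^ 2) n m *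
          ((-q) ^ (-(m : ℤ)) * q ^ ((m : ℤ) ^ 2) * (x * q ^ 2) ^ m)) +
        gaussBin (q ^ 2) n (m + 1) * ((-q) ^ (-((m + 1 : ℕ) : ℤ)) *
          q ^ (((m + 1 : ℕ) : ℤ) ^ 2) * (x * q ^ 2) ^ (m + 1)) := by
      intro m _
      have := hc m
      rw [mul_pow, mul_pow]
      linear_combination gaussBin (q ^ 2) n m * x ^ (m + 1) * this
    rw [Finset.sum_congr rfl hsplit, Finset.sum_add_distrib, ← Finset.mul_sum, add_assoc]
    have htail := Finset.sum_range_succ' (fun m => gaussBin (q ^ 2) n m *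
      ((-q) ^ (-(m : ℤ)) * q ^ ((m : ℤ) ^ 2) * (x * q ^ 2) ^ m)) (n + 1)
    rw [Finset.sum_range_succ, gaussBin_eq_zero_of_lt _ (Nat.lt_succ_self n)] at htail
    simp only [pow_zero, gaussBin_zero_right] at htail ⊢
    rw [← htail]
    ring

/-! ### Quadratic monomials -/

/-- Functions of the shape `x ↦ (-q)^{s(x)} a^{t(x)} q^{B(x,x)}` with `s`, `t` linear and `B`
symmetric bilinear over `ℤ`. -/
def IsQuadMonomial {M : Type*} [AddCommGroup M] (f : M → F) : Prop :=
  ∃ (s t : M →ₗ[ℤ] ℤ) (B : M →ₗ[ℤ] M →ₗ[ℤ] ℤ), (∀ x y, B x y = B y x) ∧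
    ∀ x, f x = (-q) ^ s x * a ^ t x * q ^ B x x

namespace IsQuadMonomial

variable {M N : Type*} [AddCommGroup M] [AddCommGroup N]

lemma one : IsQuadMonomial fun _ : M => (1 : F) :=
  ⟨0, 0, 0, by simp, by simp⟩

lemma mul {f g : M → F} (hf : IsQuadMonomial f) (hg : IsQuadMonomial g) :
    IsQuadMonomial fun x => f x * g x := by
  obtain ⟨s, t, B, hB, hf⟩ := hf
  obtain ⟨s', t', B', hB', hg⟩ := hg
  refine ⟨s + s', t + t', B + B', fun x y => by simp [hB x y, hB' x y], fun x => ?_⟩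
  simp only [hf, hg, LinearMap.add_apply, zpow_add₀ neg_q_ne_zero, zpow_add₀ a_ne_zero,
    zpow_add₀ q_ne_zero]
  ring

lemma comp {f : M → F} (hf : IsQuadMonomial f) (L : N →ₗ[ℤ] M) :
    IsQuadMonomial fun x => f (L x) := by
  obtain ⟨s, t, B, hB, hf⟩ := hf
  exact ⟨s ∘ₗ L, t ∘ₗ L, B.compl₁₂ L L, fun x y => by simp [hB (L x)], fun x => by simp [hf]⟩

lemma q_sq_zpow (B : M →ₗ[ℤ] N →ₗ[ℤ] ℤ) (L : M →ₗ[ℤ] N) :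
    IsQuadMonomial fun x => (q ^ 2) ^ B x (L x) := by
  refine ⟨0, 0, B.compl₂ L + (B.compl₂ L).flip, fun x y => by simp [add_comm], fun x => ?_⟩
  simp [← two_mul, zpow_mul]

/-- A quadratic monomial in three integer variables, given by its coefficients. -/
lemma of_coeffs (s₁ s₂ s₃ t₁ t₂ t₃ d₁ d₂ d₃ c₁₂ c₁₃ c₂₃ : ℤ) :
    IsQuadMonomial fun u : ℤ × ℤ × ℤ =>
      (-q) ^ (s₁ * u.1 + s₂ * u.2.1 + s₃ * u.2.2) * a ^ (t₁ * u.1 + t₂ * u.2.1 + t₃ * u.2.2) *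
        q ^ (d₁ * u.1 ^ 2 + d₂ * u.2.1 ^ 2 + d₃ * u.2.2 ^ 2 +
          2 * (c₁₂ * u.1 * u.2.1 + c₁₃ * u.1 * u.2.2 + c₂₃ * u.2.1 * u.2.2)) := by
  let p₁ : ℤ × ℤ × ℤ →ₗ[ℤ] ℤ := LinearMap.fst ℤ ℤ (ℤ × ℤ)
  let p₂ : ℤ × ℤ × ℤ →ₗ[ℤ] ℤ := LinearMap.fst ℤ ℤ ℤ ∘ₗ LinearMap.snd ℤ ℤ (ℤ × ℤ)
  let p₃ : ℤ × ℤ × ℤ →ₗ[ℤ] ℤ := LinearMap.snd ℤ ℤ ℤ ∘ₗ LinearMap.snd ℤ ℤ (ℤ × ℤ)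
  refine ⟨s₁ • p₁ + s₂ • p₂ + s₃ • p₃, t₁ • p₁ + t₂ • p₂ + t₃ • p₃,
    p₁.smulRight (d₁ • p₁ + c₁₂ • p₂ + c₁₃ • p₃) + p₂.smulRight (c₁₂ • p₁ + d₂ • p₂ + c₂₃ • p₃) +
      p₃.smulRight (c₁₃ • p₁ + c₂₃ • p₂ + d₃ • p₃), ?_, ?_⟩
  · rintro ⟨x₁, x₂, x₃⟩ ⟨y₁, y₂, y₃⟩
    simp only [p₁, p₂, p₃, LinearMap.add_apply, LinearMap.smulRight_apply, LinearMap.smul_apply,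
      LinearMap.comp_apply, LinearMap.fst_apply, LinearMap.snd_apply, smul_eq_mul]
    ring
  · rintro ⟨x₁, x₂, x₃⟩
    simp only [p₁, p₂, p₃, LinearMap.add_apply, LinearMap.smulRight_apply, LinearMap.smul_apply,
      LinearMap.comp_apply, LinearMap.fst_apply, LinearMap.snd_apply, smul_eq_mul]
    congr 2
    ring

end IsQuadMonomial

/-! ### Sums over compositions -/

/-- The inclusion of dimension vectors into the integer lattice. -/
def toLattice {ι : Type} (d : ι → ℕ) : ι → ℤ := fun i => d i

/-- The sum of the coordinates. -/
def total (ι : Type) [Fintype ι] : (ι → ℤ) →ₗ[ℤ] ℤ := ∑ i, LinearMap.proj i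

/-- The product `∏ᵢ (q²;q²)_{dᵢ}`. -/
def qpProd {ι : Type} [Fintype ι] (d : ι → ℕ) : F := ∏ i, qp (d i)

lemma total_toLattice {ι : Type} [Fintype ι] [DecidableEq ι] {d : ι → ℕ} {n : ℕ}
    (hd : d ∈ piAntidiag univ n) : total ι (toLattice d) = n := by
  rw [mem_piAntidiag] at hd
  simp [total, toLattice, ← hd.1]

lemma sum_piAntidiag_sum {α β : Type} [Fintype α] [DecidableEq α] [Fintype β] [DecidableEq β]
    (n : ℕ) (f : (α → ℕ) → (β → ℕ) → F) :
    ∑ z ∈ piAntidiag (univ : Finset (α ⊕ β)) n, f (z ∘ Sum.inl) (z ∘ Sum.inr) =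
      ∑ p ∈ antidiagonal n, ∑ x ∈ piAntidiag univ p.1, ∑ y ∈ piAntidiag univ p.2, f x y := by
  simp_rw [← Finset.sum_product']
  rw [Finset.sum_sigma']
  refine Finset.sum_bij' (fun z _ => ⟨(∑ i, z (Sum.inl i), ∑ i, z (Sum.inr i)),
    (z ∘ Sum.inl, z ∘ Sum.inr)⟩) (fun s _ => Sum.elim s.2.1 s.2.2) ?_ ?_ ?_ ?_ ?_
  · intro z hz
    simp_all
  · rintro ⟨⟨b, c⟩, x, y⟩ h
    simp only [mem_sigma, HasAntidiagonal.mem_antidiagonal, mem_product, mem_piAntidiag] at h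
    simp only [mem_piAntidiag, Fintype.sum_sum_type, Sum.elim_inl, Sum.elim_inr]
    exact ⟨by rw [h.2.1.1, h.2.2.1, h.1], by simp⟩
  · intro z _
    simp
  · rintro ⟨⟨b, c⟩, x, y⟩ h
    simp only [mem_sigma, HasAntidiagonal.mem_antidiagonal, mem_product, mem_piAntidiag] at h
    obtain ⟨-, ⟨rfl, -⟩, rfl, -⟩ := h
    simp
  · intro z _
    rfl

lemma qpProd_comp_mul {α β : Type} [Fintype α] [Fintype β] (z : α ⊕ β → ℕ) :
    qpProd (z ∘ Sum.inl) * qpProd (z ∘ Sum.inr) = qpProd z := by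
  simp [qpProd, Fintype.prod_sum_type]

/-- The multi-index `q`-Vandermonde convolution. -/
lemma exists_gaussBin_sum_eq {ι : Type} [DecidableEq ι] (s : Finset ι) :
    ∃ B : (ι → ℤ) →ₗ[ℤ] (ι → ℤ) →ₗ[ℤ] ℤ,
      (∀ x x' y y', (∀ i ∈ s, x i = x' i ∧ y i = y' i) → B x y = B x' y') ∧
      ∀ (d : ι → ℕ) (m : ℕ), gaussBin (q ^ 2) (∑ i ∈ s, d i) m = ∑ y ∈ piAntidiag s m,
        (∏ i ∈ s, gaussBin (q ^ 2) (d i) (y i)) *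
          (q ^ 2) ^ B (toLattice d - toLattice y) (toLattice y) := by
  induction s using Finset.cons_induction with
  | empty =>
    refine ⟨0, by simp, fun d m => ?_⟩
    rcases m with _ | m <;> simp
  | cons i s hi ih =>
    obtain ⟨B, hB, h⟩ := ih
    refine ⟨B + (LinearMap.proj i : (ι → ℤ) →ₗ[ℤ] ℤ).smulRight
      (∑ k ∈ s, (LinearMap.proj k : (ι → ℤ) →ₗ[ℤ] ℤ)), ?_, ?_⟩
    · intro x x' y y' hxy
      have h1 := hB x x' y y' fun k hk => hxy k (mem_cons_of_mem hk)
      have h2 := (hxy i (mem_cons_self i s)).1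
      have h3 : ∑ k ∈ s, y k = ∑ k ∈ s, y' k :=
        Finset.sum_congr rfl fun k hk => (hxy k (mem_cons_of_mem hk)).2
      simp [h1, h2, h3]
    · intro d m
      rw [Finset.sum_cons, gaussBin_add, piAntidiag_cons, Finset.sum_disjiUnion]
      refine Finset.sum_congr rfl fun p _ => ?_
      rw [h, Finset.mul_sum, Finset.sum_mul, Finset.sum_map]
      refine Finset.sum_congr rfl fun y hy => ?_
      rw [mem_piAntidiag] at hy
      have hyi : y i = 0 := by
        by_contra h0
        exact hi (hy.2 i h0)
      have hne : ∀ k ∈ s, k ≠ i := fun k hk e => hi (e ▸ hk)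
      have hs : ∀ k ∈ s, y k + (if k = i then p.1 else 0) = y k := fun k hk => by
        simp [hne k hk]
      simp only [addRightEmbedding_apply, Pi.add_apply, Finset.prod_cons, if_true, hyi, zero_add]
      rcases lt_or_ge (d i) p.1 with hlt | hge
      · simp [gaussBin_eq_zero_of_lt _ hlt]
      have hprod : ∏ k ∈ s, gaussBin (q ^ 2) (d k) (y k + if k = i then p.1 else 0) =
          ∏ k ∈ s, gaussBin (q ^ 2) (d k) (y k) :=
        Finset.prod_congr rfl fun k hk => by rw [hs k hk]
      rw [hprod]
      have hexp : (B + (LinearMap.proj i : (ι → ℤ) →ₗ[ℤ] ℤ).smulRight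
          (∑ k ∈ s, (LinearMap.proj k : (ι → ℤ) →ₗ[ℤ] ℤ)))
          (toLattice d - toLattice (y + fun t => if t = i then p.1 else 0))
          (toLattice (y + fun t => if t = i then p.1 else 0)) =
          B (toLattice d - toLattice y) (toLattice y) + ((d i - p.1) * p.2 : ℕ) := by
        rw [LinearMap.add_apply, LinearMap.add_apply]
        congr 1
        · refine hB _ _ _ _ fun k hk => ?_
          simp [toLattice, hne k hk]
        · simp only [LinearMap.smulRight_apply, LinearMap.smul_apply, LinearMap.sum_apply,
            LinearMap.proj_apply, smul_eq_mul, toLattice, Pi.sub_apply, Pi.add_apply, hyi, if_true]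
          push_cast [hge]
          congr 1
          · simp
          · rw [← hy.1]
            push_cast
            refine Finset.sum_congr rfl fun k hk => ?_
            simp [hne k hk]
      rw [hexp, zpow_add₀ (pow_ne_zero 2 q_ne_zero), zpow_natCast]
      ring

lemma gaussBin_div_qp (x y : ℕ) :
    gaussBin (q ^ 2) (x + y) y / qp (x + y) = 1 / (qp x * qp y) := by
  have hx := qp_ne_zero x
  have hy := qp_ne_zero y
  rw [div_eq_div_iff (qp_ne_zero _) (mul_ne_zero hx hy), gaussBin_mul_qp, one_mul]

/-- Splitting a sum over compositions of `b + m` weighted by a Gaussian binomial. -/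
lemma exists_sum_gaussBin_eq (ι : Type) [Fintype ι] [DecidableEq ι] :
    ∃ B : (ι → ℤ) →ₗ[ℤ] (ι → ℤ) →ₗ[ℤ] ℤ, ∀ (f : (ι → ℕ) → F) (b m : ℕ),
      gaussBin (q ^ 2) (b + m) m * ∑ d ∈ piAntidiag univ (b + m), f d / qpProd d =
        ∑ x ∈ piAntidiag univ b, ∑ y ∈ piAntidiag univ m,
          (q ^ 2) ^ B (toLattice x) (toLattice y) * f (x + y) / (qpProd x * qpProd y) := by
  obtain ⟨B, -, hB⟩ := exists_gaussBin_sum_eq (univ : Finset ι)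
  refine ⟨B, fun f b m => ?_⟩
  have hd : ∀ d ∈ piAntidiag (univ : Finset ι) (b + m),
      gaussBin (q ^ 2) (b + m) m * (f d / qpProd d) = ∑ y ∈ piAntidiag univ m,
        (∏ i, gaussBin (q ^ 2) (d i) (y i)) *
          (q ^ 2) ^ B (toLattice d - toLattice y) (toLattice y) * (f d / qpProd d) := by
    intro d hd
    rw [mem_piAntidiag] at hd
    rw [← Finset.sum_mul, ← hB, hd.1]
  rw [Finset.mul_sum, Finset.sum_congr rfl hd, Finset.sum_comm,
    Finset.sum_comm (s := piAntidiag univ b)]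
  refine Finset.sum_congr rfl fun y hy => ?_
  have hmap : (piAntidiag (univ : Finset ι) b).map (addRightEmbedding y) ⊆
      piAntidiag univ (b + m) := by
    intro d hd
    simp only [mem_map, mem_piAntidiag, addRightEmbedding_apply] at hd hy ⊢
    obtain ⟨x, hx, rfl⟩ := hd
    exact ⟨by simp [Finset.sum_add_distrib, hx.1, hy.1], by simp⟩
  rw [← Finset.sum_subset hmap, Finset.sum_map]
  · refine Finset.sum_congr rfl fun x _ => ?_
    have h1 : toLattice (x + y) - toLattice y = toLattice x := by
      ext i
      simp [toLattice]
    have h2 : (∏ i, gaussBin (q ^ 2) (x i + y i) (y i)) / qpProd (x + y) =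
        1 / (qpProd x * qpProd y) := by
      simp only [qpProd, Pi.add_apply, ← Finset.prod_div_distrib, ← Finset.prod_mul_distrib,
        gaussBin_div_qp]
      rw [Finset.prod_div_distrib, Finset.prod_const_one]
    simp only [addRightEmbedding_apply, h1, Pi.add_apply]
    linear_combination (q ^ 2) ^ B (toLattice x) (toLattice y) * f (x + y) * h2
  · intro d hd hd'
    have : ∃ i, d i < y i := by
      by_contra! hle
      refine hd' (mem_map.2 ⟨d - y, ?_, ?_⟩)
      · rw [mem_piAntidiag] at hd hy ⊢
        refine ⟨?_, by simp⟩
        have : ∑ i, (d i - y i) + ∑ i, y i = ∑ i, d i := by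
          rw [← Finset.sum_add_distrib]
          exact Finset.sum_congr rfl fun i _ => Nat.sub_add_cancel (hle i)
        rw [hd.1, hy.1] at this
        exact Nat.add_right_cancel this
      · ext i
        exact Nat.sub_add_cancel (hle i)
    obtain ⟨i, hi⟩ := this
    rw [Finset.prod_eq_zero (mem_univ i) (gaussBin_eq_zero_of_lt _ hi)]
    simp

/-! ### Quiver forms in one, two and three blocks of variables -/

/-- Families `P_n` given by a quiver generating function with vertex set `ι`. -/
def IsQuiverForm (P : ℕ → F) : Prop :=
  ∃ (ι : Type) (_ : Fintype ι) (_ : DecidableEq ι) (f : (ι → ℤ) → F),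
    Nonempty ι ∧ IsQuadMonomial f ∧
      ∀ n, P n = ∑ x ∈ piAntidiag univ n, f (toLattice x) / qpProd x

/-- Families given by a quiver generating function whose vertices form two blocks. -/
def IsQuiverForm₂ (W : ℕ → ℕ → F) : Prop :=
  ∃ (α β : Type) (_ : Fintype α) (_ : DecidableEq α) (_ : Fintype β) (_ : DecidableEq β)
    (f : (α → ℤ) × (β → ℤ) → F), Nonempty (α ⊕ β) ∧ IsQuadMonomial f ∧
      ∀ b c, W b c = ∑ x ∈ piAntidiag univ b, ∑ y ∈ piAntidiag univ c,
        f (toLattice x, toLattice y) / (qpProd x * qpProd y)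

/-- Families given by a quiver generating function whose vertices form three blocks. -/
def IsQuiverForm₃ (W : ℕ → ℕ → ℕ → F) : Prop :=
  ∃ (α β γ : Type) (_ : Fintype α) (_ : DecidableEq α) (_ : Fintype β) (_ : DecidableEq β)
    (_ : Fintype γ) (_ : DecidableEq γ)
    (f : (α → ℤ) × (β → ℤ) × (γ → ℤ) → F), Nonempty (α ⊕ β ⊕ γ) ∧ IsQuadMonomial f ∧
      ∀ b m c, W b m c = ∑ x ∈ piAntidiag univ b, ∑ y ∈ piAntidiag univ m,
        ∑ z ∈ piAntidiag univ c,
          f (toLattice x, toLattice y, toLattice z) / (qpProd x * qpProd y * qpProd z)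

/-- Restriction of a vector on a disjoint union to the left summand. -/
def restrictInl (α β : Type) : (α ⊕ β → ℤ) →ₗ[ℤ] (α → ℤ) := LinearMap.funLeft ℤ ℤ Sum.inl

/-- Restriction of a vector on a disjoint union to the right summand. -/
def restrictInr (α β : Type) : (α ⊕ β → ℤ) →ₗ[ℤ] (β → ℤ) := LinearMap.funLeft ℤ ℤ Sum.inr

lemma restrictInl_toLattice {α β : Type} (z : α ⊕ β → ℕ) :
    restrictInl α β (toLattice z) = toLattice (z ∘ Sum.inl) := rfl

lemma restrictInr_toLattice {α β : Type} (z : α ⊕ β → ℕ) :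
    restrictInr α β (toLattice z) = toLattice (z ∘ Sum.inr) := rfl

namespace IsQuiverForm₂

variable {W : ℕ → ℕ → F}

lemma swap (hW : IsQuiverForm₂ W) : IsQuiverForm₂ fun b c => W c b := by
  obtain ⟨α, β, _, _, _, _, f, hne, hf, h⟩ := hW
  refine ⟨β, α, inferInstance, inferInstance, inferInstance, inferInstance, fun u => f (u.2, u.1),
    hne.map Sum.swap, hf.comp ((LinearMap.snd ℤ _ _).prod (LinearMap.fst ℤ _ _)), fun b c => ?_⟩
  dsimp only
  rw [h, Finset.sum_comm]
  simp only [mul_comm]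

lemma sum_antidiagonal (hW : IsQuiverForm₂ W) :
    IsQuiverForm fun n => ∑ p ∈ antidiagonal n, W p.1 p.2 := by
  obtain ⟨α, β, _, _, _, _, f, hne, hf, h⟩ := hW
  refine ⟨α ⊕ β, inferInstance, inferInstance, fun u => f (restrictInl α β u, restrictInr α β u),
    hne, hf.comp ((restrictInl α β).prod (restrictInr α β)), fun n => ?_⟩
  simp only [h, restrictInl_toLattice, restrictInr_toLattice, ← qpProd_comp_mul]
  exact (sum_piAntidiag_sum n fun x y =>
    f (toLattice x, toLattice y) / (qpProd x * qpProd y)).symm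

lemma split (hW : IsQuiverForm₂ W) :
    IsQuiverForm₃ fun b m c => gaussBin (q ^ 2) (b + m) m * W (b + m) c := by
  obtain ⟨α, β, _, _, _, _, f, hne, hf, h⟩ := hW
  obtain ⟨B, hB⟩ := exists_sum_gaussBin_eq α
  let p₁ := LinearMap.fst ℤ (α → ℤ) ((α → ℤ) × (β → ℤ))
  let p₂ := LinearMap.fst ℤ (α → ℤ) (β → ℤ) ∘ₗ LinearMap.snd ℤ (α → ℤ) ((α → ℤ) × (β → ℤ))
  let p₃ := LinearMap.snd ℤ (α → ℤ) (β → ℤ) ∘ₗ LinearMap.snd ℤ (α → ℤ) ((α → ℤ) × (β → ℤ))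
  refine ⟨α, α, β, inferInstance, inferInstance, inferInstance, inferInstance, inferInstance,
    inferInstance, fun u => (q ^ 2) ^ B u.1 u.2.1 * f (u.1 + u.2.1, u.2.2),
    hne.map fun x => Sum.inr x, ?_, fun b m c => ?_⟩
  · exact (IsQuadMonomial.q_sq_zpow (B ∘ₗ p₁) p₂).mul (hf.comp ((p₁ + p₂).prod p₃))
  · dsimp only
    rw [h, Finset.sum_comm, Finset.mul_sum]
    have key := fun y : β → ℕ => hB (fun d => f (toLattice d, toLattice y) / qpProd y) b m
    simp only [div_div, mul_comm (qpProd (_ : β → ℕ))] at key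
    simp only [key]
    rw [Finset.sum_comm]
    refine Finset.sum_congr rfl fun x _ => ?_
    rw [Finset.sum_comm]
    refine Finset.sum_congr rfl fun y _ => Finset.sum_congr rfl fun z _ => ?_
    have hadd : toLattice (x + y) = toLattice x + toLattice y := by
      ext i
      simp [toLattice]
    rw [hadd, mul_div_assoc', div_div]
    congr 1
    ring

lemma mul (hW : IsQuiverForm₂ W) {μ : ℤ × ℤ × ℤ → F} (hμ : IsQuadMonomial μ) :
    IsQuiverForm₂ fun b c => μ (b, 0, c) * W b c := by
  obtain ⟨α, β, _, _, _, _, f, hne, hf, h⟩ := hW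
  let L : (α → ℤ) × (β → ℤ) →ₗ[ℤ] ℤ × ℤ × ℤ := (total α ∘ₗ LinearMap.fst ℤ _ _).prod
    (LinearMap.prod 0 (total β ∘ₗ LinearMap.snd ℤ _ _))
  refine ⟨α, β, inferInstance, inferInstance, inferInstance, inferInstance, fun u => μ (L u) * f u,
    hne, (hμ.comp L).mul hf, fun b c => ?_⟩
  dsimp only
  rw [h, Finset.mul_sum]
  refine Finset.sum_congr rfl fun x hx => ?_
  rw [Finset.mul_sum]
  refine Finset.sum_congr rfl fun y hy => ?_
  have hL : L (toLattice x, toLattice y) = ((b : ℤ), 0, (c : ℤ)) := by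
    simp [L, total_toLattice hx, total_toLattice hy]
  rw [hL, mul_div_assoc]

end IsQuiverForm₂

namespace IsQuiverForm₃

variable {W : ℕ → ℕ → ℕ → F}

lemma mul (hW : IsQuiverForm₃ W) {μ : ℤ × ℤ × ℤ → F} (hμ : IsQuadMonomial μ) :
    IsQuiverForm₃ fun b m c => μ (b, m, c) * W b m c := by
  obtain ⟨α, β, γ, _, _, _, _, _, _, f, hne, hf, h⟩ := hW
  let L : (α → ℤ) × (β → ℤ) × (γ → ℤ) →ₗ[ℤ] ℤ × ℤ × ℤ :=
    (total α).prodMap ((total β).prodMap (total γ))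
  refine ⟨α, β, γ, inferInstance, inferInstance, inferInstance, inferInstance, inferInstance,
    inferInstance, fun u => μ (L u) * f u, hne, (hμ.comp L).mul hf, fun b m c => ?_⟩
  dsimp only
  rw [h, Finset.mul_sum]
  refine Finset.sum_congr rfl fun x hx => ?_
  rw [Finset.mul_sum]
  refine Finset.sum_congr rfl fun y hy => ?_
  rw [Finset.mul_sum]
  refine Finset.sum_congr rfl fun z hz => ?_
  have hL : L (toLattice x, toLattice y, toLattice z) = ((b : ℤ), (m : ℤ), (c : ℤ)) := by
    simp [L, total_toLattice hx, total_toLattice hy, total_toLattice hz]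
  rw [hL, mul_div_assoc]

lemma sum_antidiagonal_right (hW : IsQuiverForm₃ W) :
    IsQuiverForm₂ fun b n => ∑ p ∈ antidiagonal n, W b p.1 p.2 := by
  obtain ⟨α, β, γ, _, _, _, _, _, _, f, hne, hf, h⟩ := hW
  refine ⟨α, β ⊕ γ, inferInstance, inferInstance, inferInstance, inferInstance,
    fun u => f (u.1, restrictInl β γ u.2, restrictInr β γ u.2), hne,
    hf.comp (LinearMap.prodMap LinearMap.id ((restrictInl β γ).prod (restrictInr β γ))),
    fun b n => ?_⟩
  simp only [h, restrictInl_toLattice, restrictInr_toLattice]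
  rw [Finset.sum_comm]
  refine Finset.sum_congr rfl fun x _ => ?_
  simp only [← qpProd_comp_mul (α := β), mul_assoc]
  exact (sum_piAntidiag_sum n fun y z =>
    f (toLattice x, toLattice y, toLattice z) / (qpProd x * (qpProd y * qpProd z))).symm

lemma rotate (hW : IsQuiverForm₃ W) : IsQuiverForm₃ fun c b m => W b m c := by
  obtain ⟨α, β, γ, _, _, _, _, _, _, f, hne, hf, h⟩ := hW
  let p₁ := LinearMap.fst ℤ (γ → ℤ) ((α → ℤ) × (β → ℤ))
  let p₂ := LinearMap.snd ℤ (γ → ℤ) ((α → ℤ) × (β → ℤ))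
  refine ⟨γ, α, β, inferInstance, inferInstance, inferInstance, inferInstance, inferInstance,
    inferInstance, fun u => f (u.2.1, u.2.2, u.1),
    hne.map fun x => x.elim (fun i => .inr (.inl i)) (Sum.elim (fun i => .inr (.inr i)) .inl),
    hf.comp ((LinearMap.fst ℤ _ _ ∘ₗ p₂).prod ((LinearMap.snd ℤ _ _ ∘ₗ p₂).prod p₁)),
    fun c b m => ?_⟩
  dsimp only
  rw [h, Finset.sum_comm (s := piAntidiag univ c)]
  refine Finset.sum_congr rfl fun x _ => ?_
  rw [Finset.sum_comm]
  refine Finset.sum_congr rfl fun z _ => Finset.sum_congr rfl fun y _ => ?_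
  congr 1
  ring

lemma sum_antidiagonal_left (hW : IsQuiverForm₃ W) :
    IsQuiverForm₂ fun n c => ∑ p ∈ antidiagonal n, W p.1 p.2 c :=
  hW.rotate.sum_antidiagonal_right.swap

end IsQuiverForm₃

lemma IsQuiverForm₂.mul_qPoch {W : ℕ → ℕ → F} (hW : IsQuiverForm₂ W) (r e₀ e₁ e₂ : ℤ) :
    IsQuiverForm₂ fun n c => qPoch (a ^ r * q ^ (2 * (e₀ + e₁ * n + e₂ * c))) (q ^ 2) n * W n c := by
  convert (hW.split.mul (IsQuadMonomial.of_coeffs 0 (2 * e₀ - 1) 0 0 r 0 0 (1 + 2 * e₁) 0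
    e₁ 0 e₂)).sum_antidiagonal_left using 3 with n c
  rw [qPoch_eq_sum, Finset.sum_mul]
  refine Finset.sum_congr rfl fun p hp => ?_
  obtain ⟨b, m⟩ := p
  obtain rfl : b + m = n := HasAntidiagonal.mem_antidiagonal.1 hp
  have hs : (-q) ^ (0 * (b : ℤ) + (2 * e₀ - 1) * m + 0 * c) =
      (-q) ^ (-(m : ℤ)) * q ^ (2 * e₀ * m) := by
    rw [show (0 * (b : ℤ) + (2 * e₀ - 1) * m + 0 * c) = -(m : ℤ) + 2 * (e₀ * m) by ring,
      zpow_add₀ neg_q_ne_zero, zpow_mul (-q) 2, mul_assoc 2 e₀, zpow_mul q 2]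
    simp
  have ht : (a ^ r * q ^ (2 * (e₀ + e₁ * (b + m : ℕ) + e₂ * c))) ^ m =
      a ^ (r * m) * (q ^ (2 * e₀ * m) * q ^ (2 * (e₁ * (b + m) + e₂ * c) * m)) := by
    rw [mul_pow, ← zpow_natCast, ← zpow_mul, ← zpow_natCast, ← zpow_mul, ← zpow_add₀ q_ne_zero]
    congr 2
    push_cast
    ring
  have hd : q ^ (0 * (b : ℤ) ^ 2 + (1 + 2 * e₁) * (m : ℤ) ^ 2 + 0 * (c : ℤ) ^ 2 +
      2 * (e₁ * b * m + 0 * b * c + e₂ * m * c)) =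
      q ^ ((m : ℤ) ^ 2) * q ^ (2 * (e₁ * (b + m) + e₂ * c) * m) := by
    rw [← zpow_add₀ q_ne_zero]
    congr 1
    ring
  have ha : a ^ (0 * (b : ℤ) + r * m + 0 * c) = a ^ (r * m) := by
    congr 1
    ring
  dsimp only
  rw [hs, ht, hd, ha]
  ring

/-! ### States of quiver form -/

/-- Families of state vectors which, after rescaling, are given by a quiver generating function
with one block of vertices for `j - k` and one for `k`. -/
def IsQuiverState (V : (j : ℕ) → Fin (j + 1) → F) : Prop :=
  ∃ W, IsQuiverForm₂ W ∧ ∀ j (k : Fin (j + 1)), V j k = qp (j - k) * qp k * W (j - k) k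

lemma isQuiverState_e0 : IsQuiverState e0 := by
  refine ⟨fun b c => if c = 0 then 1 / qp b else 0, ⟨Unit, Empty, inferInstance, inferInstance,
    inferInstance, inferInstance, fun _ => 1, inferInstance, .one, fun b c => ?_⟩, fun j k => ?_⟩
  · have hU : piAntidiag (univ : Finset Unit) b = {fun _ => b} := by
      ext d
      simp only [mem_piAntidiag, mem_singleton, funext_iff, univ_unique, sum_singleton]
      exact ⟨fun h _ => h.1, fun h => ⟨h _, fun _ _ => trivial⟩⟩
    rw [hU, Finset.sum_singleton, Finset.univ_eq_empty, piAntidiag_empty]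
    split_ifs with hc <;> simp [qpProd, hc]
  · rw [e0]
    split_ifs with hk
    · simp [hk, qp_zero, qp_ne_zero]
    · dsimp only
      rw [if_neg hk, mul_zero]

lemma exists_coef_T (X : TangleType) : ∃ μ : ℤ × ℤ × ℤ → F, IsQuadMonomial μ ∧
    ∀ b m c : ℕ, coef Letter.T X (b + m + c) c (m + c) = μ (b, m, c) * qbin (m + c) c := by
  cases X
  · refine ⟨_, .of_coeffs (-1) 0 0 0 0 0 0 0 1 0 0 0, fun b m c => ?_⟩
    rw [coef, if_pos (by omega)]
    dsimp only
    push_cast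
    rw [show (0 : ℤ) * b + 0 * m + 0 * c = 0 by ring, zpow_zero, mul_one]
    congr 3 <;> ring
  · refine ⟨_, .of_coeffs 0 1 1 0 0 1 0 0 (-1) 0 (-1) (-1), fun b m c => ?_⟩
    rw [coef, if_pos (by omega)]
    dsimp only
    push_cast
    congr 3 <;> [(congr 1; ring); (congr 1; ring); ring]
  · refine ⟨_, .of_coeffs 0 1 1 0 1 1 0 (-2) (-1) (-1) (-1) (-2), fun b m c => ?_⟩
    rw [coef, if_pos (by omega)]
    dsimp only
    push_cast
    congr 3 <;> [(congr 1; ring); (congr 1; ring); ring]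

lemma exists_coef_R (X : TangleType) : ∃ μ : ℤ × ℤ × ℤ → F, IsQuadMonomial μ ∧
    ∀ h m b : ℕ, coef Letter.R X (h + m + b) (h + m) h = μ (h, m, b) * qbin (b + m) m := by
  have e (h m b : ℕ) : qbin (h + m + b - h) (h + m - h) = qbin (b + m) m := by
    congr 1 <;> omega
  cases X
  · refine ⟨_, .of_coeffs 0 (-1) (-1) 0 (-1) (-1) 0 2 1 1 1 1, fun h m b => ?_⟩
    rw [coef, if_pos (by omega), e]
    dsimp only
    push_cast
    congr 3 <;> [(congr 1; ring); (congr 1; ring); ring]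
  · refine ⟨_, .of_coeffs 0 (-1) (-1) 0 0 (-1) 0 0 1 0 1 0, fun h m b => ?_⟩
    rw [coef, if_pos (by omega), e]
    dsimp only
    push_cast
    congr 3 <;> [(congr 1; ring); (congr 1; ring); ring]
  · refine ⟨_, .of_coeffs 1 0 0 0 0 0 0 0 (-1) 0 0 (-1), fun h m b => ?_⟩
    rw [coef, if_pos (by omega), e]
    dsimp only
    push_cast
    rw [show (0 : ℤ) * h + 0 * m + 0 * b = 0 by ring, zpow_zero, mul_one]
    congr 3 <;> ring

lemma coef_T_eq_zero (X : TangleType) {j k h : ℕ} (hk : h < k) : coef Letter.T X j k h = 0 := by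
  cases X <;> simp [coef, hk.not_ge]

lemma coef_R_eq_zero (X : TangleType) {j k h : ℕ} (hk : k < h) : coef Letter.R X j k h = 0 := by
  cases X <;> simp [coef, hk.not_ge]

lemma sum_range_succ_eq_sum_antidiagonal (φ : ℕ → F) (n : ℕ) :
    ∑ k ∈ range (n + 1), φ k = ∑ p ∈ antidiagonal n, φ p.2 := by
  rw [← Finset.Nat.sum_antidiagonal_swap]
  simp only [Prod.snd_swap]
  rw [Finset.Nat.sum_antidiagonal_eq_sum_range_succ_mk]

lemma IsQuiverState.step {V : (j : ℕ) → Fin (j + 1) → F} (hV : IsQuiverState V) (l : Letter)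
    (X : TangleType) : IsQuiverState fun j => stepVec l X j (V j) := by
  obtain ⟨W, hW, hV⟩ := hV
  cases l
  · obtain ⟨μ, hμ, hcoef⟩ := exists_coef_T X
    refine ⟨_, (hW.split.mul hμ).sum_antidiagonal_right, fun j h => ?_⟩
    obtain ⟨h, hh⟩ := h
    obtain ⟨b, rfl⟩ := Nat.exists_eq_add_of_le' (Nat.lt_succ_iff.1 hh)
    simp only [stepVec, hV]
    rw [Fin.sum_univ_eq_sum_range (fun k => qp (b + h - k) * qp k * W (b + h - k) k *
      coef Letter.T X (b + h) k h),
      ← Finset.sum_subset (Finset.range_mono (show h + 1 ≤ b + h + 1 by omega))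
        (fun k _ hk => by rw [coef_T_eq_zero X (by simpa using hk), mul_zero]),
      sum_range_succ_eq_sum_antidiagonal, Nat.add_sub_cancel, Finset.mul_sum]
    refine Finset.sum_congr rfl fun p hp => ?_
    obtain ⟨m, c⟩ := p
    obtain rfl : m + c = h := HasAntidiagonal.mem_antidiagonal.1 hp
    dsimp only
    rw [← add_assoc, Nat.add_sub_cancel, hcoef, ← gaussBin_mul_qp b m, ← qbin_mul_qp m c]
    ring
  · obtain ⟨μ, hμ, hcoef⟩ := exists_coef_R X
    refine ⟨_, (hW.swap.split.mul hμ).sum_antidiagonal_right.swap, fun j h => ?_⟩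
    obtain ⟨h, hh⟩ := h
    obtain ⟨n, rfl⟩ := Nat.exists_eq_add_of_le (Nat.lt_succ_iff.1 hh)
    simp only [stepVec, hV]
    rw [Fin.sum_univ_eq_sum_range (fun k => qp (h + n - k) * qp k * W (h + n - k) k *
      coef Letter.R X (h + n) k h), add_assoc, Finset.sum_range_add,
      Finset.sum_eq_zero (s := range h)
        (fun k hk => by rw [coef_R_eq_zero X (by simpa using hk), mul_zero]),
      zero_add, sum_range_succ_eq_sum_antidiagonal, ← Finset.Nat.sum_antidiagonal_swap,
      Nat.add_sub_cancel_left, Finset.mul_sum]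
    refine Finset.sum_congr rfl fun p hp => ?_
    obtain ⟨m, b⟩ := p
    obtain rfl : m + b = n := HasAntidiagonal.mem_antidiagonal.1 hp
    dsimp only [Prod.snd_swap]
    rw [← add_assoc, Nat.add_sub_cancel_left, hcoef, add_comm m b, ← gaussBin_mul_qp h m,
      ← qbin_mul_qp b m]
    ring

lemma IsQuiverState.run {V : (j : ℕ) → Fin (j + 1) → F} (hV : IsQuiverState V) (w : List Letter)
    (X : TangleType) : IsQuiverState fun j => runVec w X j (V j) := by
  induction w generalizing V X with
  | nil => exact hV
  | cons l w ih => exact ih (hV.step l X) (typeStep l X)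

lemma IsQuiverState.closeUP {V : (j : ℕ) → Fin (j + 1) → F} (hV : IsQuiverState V) :
    IsQuiverForm fun j => closeUP j (V j) := by
  obtain ⟨W, hW, hV⟩ := hV
  convert (((hW.swap.mul_qPoch 2 1 (-2) (-1)).swap.mul_qPoch 2 1 (-1) (-1)).mul
    (.of_coeffs 0 0 0 (-1) 0 (-1) 1 0 2 0 1 0)).sum_antidiagonal using 2 with j
  simp only [_root_.closeUP, hV]
  rw [Fin.sum_univ_eq_sum_range (fun k : ℕ => qp (j - k) * qp k * W (j - k) k *
    (a ^ (-(j : ℤ)) * q ^ ((j : ℤ) ^ 2 + (k : ℤ) ^ 2) * qbin j k *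
      (qPoch (a ^ 2 * q ^ (2 - 2 * (j : ℤ) - 2 * (k : ℤ))) (q ^ 2) j / qp j))),
    sum_range_succ_eq_sum_antidiagonal]
  refine Finset.sum_congr rfl fun p hp => ?_
  obtain ⟨b, c⟩ := p
  obtain rfl : b + c = j := HasAntidiagonal.mem_antidiagonal.1 hp
  have hx : (a ^ 2 * q ^ (2 - 2 * ((b + c : ℕ) : ℤ) - 2 * (c : ℤ))) =
      a ^ (2 : ℤ) * q ^ (2 * (1 + -2 * (c : ℤ) + -1 * b)) := by
    congr 2
    push_cast
    ring
  have hy : a ^ (2 : ℤ) * q ^ (2 * (1 + -2 * (c : ℤ) + -1 * b)) * (q ^ 2) ^ c =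
      a ^ (2 : ℤ) * q ^ (2 * (1 + -1 * (b : ℤ) + -1 * c)) := by
    rw [← pow_mul, ← zpow_natCast q, mul_assoc, ← zpow_add₀ q_ne_zero]
    congr 2
    push_cast
    ring
  have hpoch : qPoch (a ^ 2 * q ^ (2 - 2 * ((b + c : ℕ) : ℤ) - 2 * (c : ℤ))) (q ^ 2) (b + c) =
      qPoch (a ^ (2 : ℤ) * q ^ (2 * (1 + -2 * (c : ℤ) + -1 * b))) (q ^ 2) c *
      qPoch (a ^ (2 : ℤ) * q ^ (2 * (1 + -1 * (b : ℤ) + -1 * c))) (q ^ 2) b := by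
    rw [hx, add_comm b c, qPoch_add, hy]
  have hmono : a ^ (-((b + c : ℕ) : ℤ)) * q ^ (((b + c : ℕ) : ℤ) ^ 2 + (c : ℤ) ^ 2) =
      (-q) ^ (0 * (b : ℤ) + 0 * 0 + 0 * c) * a ^ (-1 * (b : ℤ) + 0 * 0 + -1 * c) *
        q ^ (1 * (b : ℤ) ^ 2 + 0 * 0 ^ 2 + 2 * (c : ℤ) ^ 2 +
          2 * (0 * (b : ℤ) * 0 + 1 * b * c + 0 * 0 * c)) := by
    rw [show (0 * (b : ℤ) + 0 * 0 + 0 * c) = 0 by ring, zpow_zero, one_mul]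
    congr 2 <;> push_cast <;> ring
  have hj := qp_ne_zero (b + c)
  have hbin (μ x y w : F) : qp b * qp c * w * (μ * qbin (b + c) c * (x * y / qp (b + c))) =
      μ * (y * (x * w)) := by
    field_simp
    linear_combination μ * x * y * w * qbin_mul_qp b c
  dsimp only
  rw [Nat.add_sub_cancel, hpoch, hmono]
  exact hbin _ _ _ _

lemma IsQuiverState.closeOP {V : (j : ℕ) → Fin (j + 1) → F} (hV : IsQuiverState V) :
    IsQuiverForm fun j => closeOP j (V j) := by
  obtain ⟨W, hW, hV⟩ := hV
  convert (((hW.swap.mul_qPoch 0 1 0 1).swap.mul_qPoch 2 1 (-1) (-1)).mul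
    (.of_coeffs 0 0 0 (-1) 0 0 1 0 0 0 0 0)).sum_antidiagonal using 2 with j
  simp only [_root_.closeOP, hV]
  rw [Fin.sum_univ_eq_sum_range (fun k : ℕ => qp (j - k) * qp k * W (j - k) k *
    (a ^ ((k : ℤ) - (j : ℤ)) * q ^ (((j : ℤ) - (k : ℤ)) ^ 2) * qbin j k *
      (qPoch (a ^ 2 * q ^ (2 - 2 * (j : ℤ))) (q ^ 2) (j - k) / qp (j - k)))),
    sum_range_succ_eq_sum_antidiagonal]
  refine Finset.sum_congr rfl fun p hp => ?_
  obtain ⟨b, c⟩ := p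
  obtain rfl : b + c = j := HasAntidiagonal.mem_antidiagonal.1 hp
  have hx : a ^ 2 * q ^ (2 - 2 * ((b + c : ℕ) : ℤ)) =
      a ^ (2 : ℤ) * q ^ (2 * (1 + -1 * (b : ℤ) + -1 * c)) := by
    congr 2
    push_cast
    ring
  have hy : q ^ (2 * (b + 1)) = a ^ (0 : ℤ) * q ^ (2 * (1 + 0 * (c : ℤ) + 1 * b)) := by
    rw [zpow_zero, one_mul, ← zpow_natCast]
    congr 1
    push_cast
    ring
  have hmono : a ^ ((c : ℤ) - ((b + c : ℕ) : ℤ)) * q ^ ((((b + c : ℕ) : ℤ) - (c : ℤ)) ^ 2) =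
      (-q) ^ (0 * (b : ℤ) + 0 * 0 + 0 * c) * a ^ (-1 * (b : ℤ) + 0 * 0 + 0 * c) *
        q ^ (1 * (b : ℤ) ^ 2 + 0 * 0 ^ 2 + 0 * (c : ℤ) ^ 2 +
          2 * (0 * (b : ℤ) * 0 + 0 * b * c + 0 * 0 * c)) := by
    rw [show (0 * (b : ℤ) + 0 * 0 + 0 * c) = 0 by ring, zpow_zero, one_mul]
    congr 2 <;> push_cast <;> ring
  have hb := qp_ne_zero b
  have hbin : qbin (b + c) c * qp c = qPoch (q ^ (2 * (b + 1))) (q ^ 2) c := by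
    refine mul_left_cancel₀ hb ?_
    rw [← qp_add, ← qbin_mul_qp b c]
    ring
  have hterm (μ x w : F) : qp b * qp c * w * (μ * qbin (b + c) c * (x / qp b)) =
      μ * (x * (qPoch (q ^ (2 * (b + 1))) (q ^ 2) c * w)) := by
    rw [← hbin]
    field_simp
  rw [hy] at hterm
  dsimp only
  rw [Nat.add_sub_cancel, hx, hmono]
  exact hterm _ _ _

lemma IsQuiverForm.exists_matrix {P : ℕ → F} (hP : IsQuiverForm P) :
    ∃ n : ℕ, 1 ≤ n ∧ ∃ (Q : Matrix (Fin n) (Fin n) ℤ) (qv av : Fin n → ℤ), Q.IsSymm ∧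
      ∀ j : ℕ, P j =
        ∑ d ∈ (Fintype.piFinset fun _ : Fin n => Finset.range (j + 1)).filter
            (fun d => ∑ i, d i = j),
          (-q) ^ (∑ i, qv i * ((d i : ℕ) : ℤ)) * a ^ (∑ i, av i * ((d i : ℕ) : ℤ)) *
            q ^ (∑ i, ∑ i', ((d i : ℕ) : ℤ) * Q i i' * ((d i' : ℕ) : ℤ)) /
            ∏ i, qp (d i) := by
  obtain ⟨ι, _, _, f, hne, ⟨s, t, B, hB, hf⟩, h⟩ := hP
  let e := Fintype.equivFin ι
  let u : Fin (Fintype.card ι) → ι → ℤ := fun i => Pi.single (e.symm i) 1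
  refine ⟨Fintype.card ι, Fintype.card_pos, .of fun i i' => B (u i) (u i'), fun i => s (u i),
    fun i => t (u i), Matrix.IsSymm.ext fun i i' => hB _ _, fun j => ?_⟩
  rw [h]
  refine Finset.sum_equiv (e.arrowCongr (Equiv.refl ℕ)) (fun x => ?_) fun x _ => ?_
  · have hsum : ∑ i, x (e.symm i) = ∑ i, x i := e.symm.sum_comp x
    simp only [mem_piAntidiag, mem_filter, Fintype.mem_piFinset, mem_range, Equiv.arrowCongr_apply,
      Function.comp_apply, Equiv.refl_apply, hsum]
    refine ⟨fun hx => ⟨fun i => ?_, hx.1⟩, fun hx => ⟨hx.2, by simp⟩⟩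
    rw [← hx.1, Nat.lt_succ_iff]
    exact Finset.single_le_sum (fun _ _ => Nat.zero_le _) (mem_univ _)
  · have hlat : toLattice x = ∑ i, (x (e.symm i) : ℤ) • u i := by
      rw [e.symm.sum_comp fun i => (x i : ℤ) • (Pi.single i 1 : ι → ℤ)]
      ext i
      simp [toLattice, Finset.sum_apply, Pi.single_apply]
    have hprod : qpProd x = ∏ i, qp (x (e.symm i)) := (e.symm.prod_comp fun i => qp (x i)).symm
    rw [hf, hprod, hlat]
    simp only [map_sum, map_smul, LinearMap.sum_apply, LinearMap.smul_apply, smul_eq_mul,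
      Equiv.arrowCongr_apply, Function.comp_apply, Equiv.refl_apply, Matrix.of_apply]
    congr 2
    · simp only [mul_comm]
    · congr 1
      refine Finset.sum_congr rfl fun i _ => ?_
      rw [Finset.mul_sum]
      refine Finset.sum_congr rfl fun i' _ => ?_
      rw [hB (u i') (u i)]
      ring

/-- Links–quivers correspondence for rational links: the reduced colored HOMFLY-PT
polynomials of the numerator closure of any rational tangle are given by a quiver
generating function. -/
theorem rational_links_quiver_form (w : List Letter) (hw : w ≠ [])
    (hX : typeWord w TangleType.UP = TangleType.UP ∨
      typeWord w TangleType.UP = TangleType.OP) :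
    ∃ n : ℕ, 1 ≤ n ∧
      ∃ (Q : Matrix (Fin n) (Fin n) ℤ) (qv av : Fin n → ℤ),
        Q.IsSymm ∧
        ∀ j : ℕ,
          (if typeWord w TangleType.UP = TangleType.UP
            then closeUP j (runVec w TangleType.UP j (e0 j))
            else closeOP j (runVec w TangleType.UP j (e0 j))) =
            ∑ d ∈ (Fintype.piFinset fun _ : Fin n => Finset.range (j + 1)).filter
                (fun d => ∑ i, d i = j),
              (-q) ^ (∑ i, qv i * ((d i : ℕ) : ℤ)) * a ^ (∑ i, av i * ((d i : ℕ) : ℤ)) *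
                q ^ (∑ i, ∑ i', ((d i : ℕ) : ℤ) * Q i i' * ((d i' : ℕ) : ℤ)) /
                ∏ i, qp (d i) := by
  have hV := isQuiverState_e0.run w TangleType.UP
  split_ifs
  · exact hV.closeUP.exists_matrix
  · exact hV.closeOP.exists_matrix
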